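/- arXiv:1403.4637 — 3 statements merged into one kernel-verified Lean document; each statement's English description precedes it below -/
import Mathlib

section
/- Termination of DMIS (Theorem 1): the DMIS phase iteration reaches the empty set within |V| phases; that is, U_{Fintype.card V} = ∅ (and hence U_k = ∅ for all k ≥ Fintype.card V). -/
/-- Set of priority-local maxima of `U` in graph `G`. -/
def locMax {V : Type*} (G : SimpleGraph V) (p : V → ℕ) (U : Set V) : Set V :=
  {v | v ∈ U ∧ ∀ u ∈ U, G.Adj v u → p u < p v}

/-- DMIS phase iteration: undecided vertices after `k` phases. -/
def undecided {V : Type*} (G : SimpleGraph V) (p : V → ℕ) : ℕ → Set V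
  | 0 => Set.univ
  | k + 1 =>
      undecided G p k \
        (locMax G p (undecided G p k) ∪
          {w | ∃ v ∈ locMax G p (undecided G p k), G.Adj v w})

theorem locMax_subset {V : Type*} (G : SimpleGraph V) (p : V → ℕ) (U : Set V) :
    locMax G p U ⊆ U :=
  fun _ hv => hv.1

theorem locMax_nonempty {V : Type*} [Finite V] (G : SimpleGraph V) {p : V → ℕ}
    (hp : Function.Injective p) {U : Set V} (hU : U.Nonempty) :
    (locMax G p U).Nonempty := by
  obtain ⟨v, hv, hmax⟩ := Set.exists_max_image U p U.toFinite hU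
  exact ⟨v, hv, fun u hu hadj =>
    lt_of_le_of_ne (hmax u hu) fun h => hadj.ne (hp h).symm⟩

theorem undecided_succ_subset {V : Type*} (G : SimpleGraph V) (p : V → ℕ) (k : ℕ) :
    undecided G p (k + 1) ⊆ undecided G p k :=
  Set.sdiff_subset

theorem undecided_succ_ssubset {V : Type*} [Finite V] (G : SimpleGraph V) {p : V → ℕ}
    (hp : Function.Injective p) {k : ℕ} (hk : (undecided G p k).Nonempty) :
    undecided G p (k + 1) ⊂ undecided G p k := by
  obtain ⟨v, hv⟩ := locMax_nonempty G hp hk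
  exact (Set.ssubset_iff_of_subset (undecided_succ_subset G p k)).2
    ⟨v, locMax_subset G p _ hv, fun h => h.2 (Or.inl hv)⟩

theorem ncard_undecided_le {V : Type*} [Fintype V] (G : SimpleGraph V) {p : V → ℕ}
    (hp : Function.Injective p) (k : ℕ) :
    (undecided G p k).ncard ≤ Fintype.card V - k := by
  induction k with
  | zero => simp [undecided, Set.ncard_univ, Nat.card_eq_fintype_card]
  | succ k ih =>
    rcases (undecided G p k).eq_empty_or_nonempty with h | h
    · simp [Set.subset_empty_iff.1 (h ▸ undecided_succ_subset G p k)]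
    · have := Set.ncard_lt_ncard (undecided_succ_ssubset G hp h) (Set.toFinite _)
      omega

theorem dmis_terminates {V : Type*} [Fintype V] (G : SimpleGraph V) (p : V → ℕ)
    (hp : Function.Injective p) :
    undecided G p (Fintype.card V) = ∅ ∧
      ∀ k, Fintype.card V ≤ k → undecided G p k = ∅ := by
  have key : ∀ k, Fintype.card V ≤ k → undecided G p k = ∅ := fun k hk => by
    have := ncard_undecided_le G hp k
    exact (Set.ncard_eq_zero (Set.toFinite _)).1 (by omega)
  exact ⟨key _ le_rfl, key⟩
end

section
/- Independence of the DMIS output (first part of Theorem 2): the DMIS output set S = ⋃_k L(U_k) is an independent set of G, i.e., no two distinct vertices of S are adjacent in G. -/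
theorem undecided_antitone {V : Type*} (G : SimpleGraph V) (p : V → ℕ) :
    Antitone (undecided G p) :=
  antitone_nat_of_succ_le fun _ => Set.sdiff_subset

/-- A local maximum of a phase has no neighbor among the local maxima of that phase or of any
later one. -/
theorem not_adj_of_mem_locMax_of_le {V : Type*} {G : SimpleGraph V} {p : V → ℕ} {i j : ℕ}
    (hij : i ≤ j) {v u : V} (hv : v ∈ locMax G p (undecided G p i))
    (hu : u ∈ locMax G p (undecided G p j)) : ¬ G.Adj v u := by
  intro hadj
  rcases hij.eq_or_lt with rfl | hlt
  · exact lt_asymm (hv.2 u hu.1 hadj) (hu.2 v hv.1 hadj.symm)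
  · exact (undecided_antitone G p (Nat.succ_le_of_lt hlt) hu.1).2 (Or.inr ⟨v, hv, hadj⟩)

theorem dmis_output_independent {V : Type*} [Fintype V] (G : SimpleGraph V) (p : V → ℕ)
    (hp : Function.Injective p) :
    ∀ v ∈ ⋃ k, locMax G p (undecided G p k),
      ∀ u ∈ ⋃ k, locMax G p (undecided G p k), v ≠ u → ¬ G.Adj v u := by
  intro v hv u hu _ hadj
  obtain ⟨i, hi⟩ := Set.mem_iUnion.1 hv
  obtain ⟨j, hj⟩ := Set.mem_iUnion.1 hu
  rcases le_total i j with hij | hji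
  · exact not_adj_of_mem_locMax_of_le hij hi hj hadj
  · exact not_adj_of_mem_locMax_of_le hji hj hi hadj.symm
end

section
/- Greedy characterization of the DMIS output (the claim that removing activated nodes and their neighbors does not affect ensuing phases): a vertex v belongs to the DMIS output set S = ⋃_k L(U_k) if and only if no neighbor of v with strictly higher priority belongs to S; that is, v ∈ S ↔ ∀ u, G.Adj v u → p v < p u → u ∉ S. -/
theorem exists_undecided_eq_empty {V : Type*} [Finite V] (G : SimpleGraph V) {p : V → ℕ}
    (hp : Function.Injective p) : ∃ k, undecided G p k = ∅ := by
  obtain ⟨_, ⟨k, rfl⟩, hk⟩ :=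
    (wellFounded_lt (α := Set V)).has_min (Set.range (undecided G p)) (Set.range_nonempty _)
  refine ⟨k, Set.not_nonempty_iff_eq_empty.mp fun hne => hk _ ⟨k + 1, rfl⟩ ?_⟩
  obtain ⟨m, hm⟩ := locMax_nonempty G hp hne
  exact (Set.ssubset_iff_of_subset (undecided_succ_subset G p k)).mpr
    ⟨m, hm.1, fun h => h.2 (Or.inl hm)⟩

/-- Every vertex is decided in some phase: it is activated, or a neighbor is. -/
theorem exists_decided {V : Type*} [Finite V] (G : SimpleGraph V) {p : V → ℕ}
    (hp : Function.Injective p) (v : V) :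
    ∃ k, v ∈ undecided G p k ∧
      (v ∈ locMax G p (undecided G p k) ∨ ∃ w ∈ locMax G p (undecided G p k), G.Adj w v) := by
  by_contra! h
  obtain ⟨n, hn⟩ := exists_undecided_eq_empty G hp
  have hv : ∀ k, v ∈ undecided G p k := fun k => by
    induction k with
    | zero => exact Set.mem_univ v
    | succ k ih =>
      refine ⟨ih, ?_⟩
      rintro (hmax | ⟨w, hw, hadj⟩)
      · exact (h k ih).1 hmax
      · exact (h k ih).2 w hw hadj
  exact Set.notMem_empty v (hn ▸ hv n)

theorem dmis_output_greedy_characterization {V : Type*} [Fintype V]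
    (G : SimpleGraph V) (p : V → ℕ) (hp : Function.Injective p) (v : V) :
    v ∈ ⋃ k, locMax G p (undecided G p k) ↔
      ∀ u, G.Adj v u → p v < p u → u ∉ ⋃ k, locMax G p (undecided G p k) := by
  simp only [Set.mem_iUnion]
  constructor
  · rintro ⟨k, hk⟩ u hadj hlt ⟨j, hj⟩
    rcases lt_or_ge j k with hjk | hkj
    · exact (undecided_antitone G p hjk hk.1).2 (Or.inr ⟨u, hj, hadj.symm⟩)
    · exact lt_asymm hlt (hk.2 u (undecided_antitone G p hkj hj.1) hadj)
  · intro h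
    obtain ⟨k, hk, hmax | ⟨w, hw, hadj⟩⟩ := exists_decided G hp v
    · exact ⟨k, hmax⟩
    · exact absurd ⟨k, hw⟩ (h w hadj.symm (hw.2 v hk hadj))
end
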